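/- arXiv:2602.01292 — 2 statements merged into one kernel-verified Lean document; each statement's English description precedes it below -/
import Mathlib

section
/- Let C be the smallest class of finite graphs, closed under isomorphism, that contains the empty graph and every one-vertex graph (with or without a loop), and that is closed under the operations of connected sum ⊕̄ and disconnected sum ⊕̲. Then a finite graph is a cograph if and only if it belongs to C. In particular, every finite cograph is generated by singletons under the two sums. -/
/-- A graph `(V, E)` (with `E` a symmetric relation, loops permitted) is a *cograph*
iff for all `w, x, y, z`, if `(w,x) ∈ E`, `(y,x) ∈ E` and `(y,z) ∈ E`, then
`(y,w) ∈ E` or `(w,z) ∈ E` or `(z,x) ∈ E`. -/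
def IsCograph {V : Type*} (E : V → V → Prop) : Prop :=
  ∀ w x y z : V, E w x → E y x → E y z → E y w ∨ E w z ∨ E z x

/-- A finite graph: a finite vertex type together with an edge relation
(loops permitted). -/
structure FGraph : Type 1 where
  V : Type
  finite : Finite V
  E : V → V → Prop

/-- The connected sum `Γ ⊕̄ Δ`: the graph on the disjoint union of the vertex sets
whose edge relation is the largest relation restricting to the given ones on each
part (every vertex of one part is joined to every vertex of the other). -/
def FGraph.connSum (G H : FGraph) : FGraph where
  V := G.V ⊕ H.V
  finite := by have := G.finite; have := H.finite; exact inferInstance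
  E p q :=
    match p, q with
    | Sum.inl a, Sum.inl b => G.E a b
    | Sum.inr a, Sum.inr b => H.E a b
    | _, _ => True

/-- The disconnected sum `Γ ⊕̲ Δ`: the graph on the disjoint union of the vertex sets
whose edge relation is the smallest relation restricting to the given ones on each
part (no edges between the two parts). -/
def FGraph.discSum (G H : FGraph) : FGraph where
  V := G.V ⊕ H.V
  finite := by have := G.finite; have := H.finite; exact inferInstance
  E p q :=
    match p, q with
    | Sum.inl a, Sum.inl b => G.E a b
    | Sum.inr a, Sum.inr b => H.E a b
    | _, _ => False

/-- The smallest class of finite graphs, closed under isomorphism, containing the empty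
graph and every one-vertex graph (with or without a loop), and closed under connected
sum `⊕̄` and disconnected sum `⊕̲`. -/
inductive InC : FGraph → Prop
  | empty (G : FGraph) (h : IsEmpty G.V) : InC G
  | single (G : FGraph) (h : ∃! v : G.V, True) : InC G
  | iso (G H : FGraph) (e : G.V ≃ H.V)
      (he : ∀ a b : G.V, G.E a b ↔ H.E (e a) (e b)) : InC G → InC H
  | connSum (G H : FGraph) : InC G → InC H → InC (G.connSum H)
  | discSum (G H : FGraph) : InC G → InC H → InC (G.discSum H)

/-- The finite set `S` splits into two nonempty parts with no `E`-edge from the first part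
to the second. -/
def HasCut {V : Type*} (E : V → V → Prop) (S : Finset V) : Prop :=
  ∃ p : V → Prop, (∃ a ∈ S, p a) ∧ (∃ b ∈ S, ¬ p b) ∧
    ∀ a ∈ S, ∀ b ∈ S, p a → ¬ p b → ¬ E a b

theorem IsCograph.compl {V : Type*} {E : V → V → Prop} (hs : Symmetric E) (hE : IsCograph E) :
    IsCograph fun a b => ¬ E a b := by
  intro w x y z hwx hyx hyz
  by_contra! h
  rcases hE y w z x h.1 (hs h.2.1) h.2.2 with h' | h' | h'
  · exact hyz (hs h')
  · exact hyx h'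
  · exact hwx (hs h')

/-- Adding a vertex to a disconnected set of vertices of a cograph gives a set that is
disconnected in the graph or in its complement. -/
theorem HasCut.insert {V : Type*} [DecidableEq V] {E : V → V → Prop} (hs : Symmetric E)
    (hE : IsCograph E) {T : Finset V} {v : V} (hv : v ∉ T) (hT : HasCut E T) :
    HasCut E (insert v T) ∨ HasCut (fun a b => ¬ E a b) (insert v T) := by
  obtain ⟨p, ⟨a₀, ha₀, hpa₀⟩, ⟨b₀, hb₀, hpb₀⟩, hp⟩ := hT
  by_cases hall : ∀ b ∈ T, E v b
  · refine Or.inr ⟨fun x => x = v, ⟨v, by simp, rfl⟩, ⟨a₀, by simp [ha₀], ?_⟩, ?_⟩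
    · rintro rfl
      exact hv ha₀
    · rintro a - b hb rfl hba
      simpa using hall b ((Finset.mem_insert.1 hb).resolve_left hba)
  push Not at hall
  obtain ⟨b, hb, hvb⟩ := hall
  let R : V → V → Prop := fun x y => x ∈ T ∧ y ∈ T ∧ E x y
  let C : V → Prop := Relation.ReflTransGen R b
  have hCb : C b := Relation.ReflTransGen.refl
  have hCT : ∀ x, C x → x ∈ T := by
    intro x hx
    induction hx with
    | refl => exact hb
    | tail _ h _ => exact h.2.1
  have hCE : ∀ x y, C x → y ∈ T → E x y → C y := fun x y hx hy hxy =>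
    Relation.ReflTransGen.tail hx ⟨hCT x hx, hy, hxy⟩
  have hCp : ∀ x, C x → (p x ↔ p b) := by
    intro x hx
    induction hx with
    | refl => rfl
    | @tail y z _ h ih =>
      rw [← ih]
      by_contra hne
      by_cases hy : p y
      · exact hp y h.1 z h.2.1 hy (by tauto) h.2.2
      · exact hp z h.2.1 y h.1 (by tauto) hy (hs h.2.2)
  obtain ⟨d₀, hd₀, hCd₀⟩ : ∃ d ∈ T, ¬ C d := by
    by_cases hpb : p b
    · exact ⟨b₀, hb₀, fun h => hpb₀ ((hCp _ h).2 hpb)⟩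
    · exact ⟨a₀, ha₀, fun h => hpb ((hCp _ h).1 hpa₀)⟩
  left
  by_cases hCv : ∀ x, C x → ¬ E v x
  · refine ⟨C, ⟨b, by simp [hb], hCb⟩, ⟨d₀, by simp [hd₀], hCd₀⟩, ?_⟩
    intro x _ y hy hx hCy hxy
    rcases Finset.mem_insert.1 hy with rfl | hy
    · exact hCv x hx (hs hxy)
    · exact hCy (hCE x y hx hy hxy)
  by_cases hDv : ∀ x ∈ T, ¬ C x → ¬ E v x
  · refine ⟨fun x => x ∈ T ∧ ¬ C x, ⟨d₀, by simp [hd₀], hd₀, hCd₀⟩,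
      ⟨b, by simp [hb], fun h => h.2 hCb⟩, ?_⟩
    rintro x _ y hy ⟨hxT, hx⟩ hCy hxy
    rcases Finset.mem_insert.1 hy with rfl | hy
    · exact hDv x hxT hx (hs hxy)
    · exact hx (hCE y x (by tauto) hxT (hs hxy))
  push Not at hCv hDv
  obtain ⟨a, hCa, hva⟩ := hCv
  obtain ⟨d, hd, hCd, hvd⟩ := hDv
  have hnot : ∀ x, C x → ¬ E v x := by
    intro x hx
    induction hx with
    | refl => exact hvb
    | @tail y z hy h ih =>
      intro hvz
      rcases hE y z v d h.2.2 hvz hvd with h' | h' | h'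
      · exact ih h'
      · exact hCd (hCE y d hy hd h')
      · exact hCd (hCE z d (hCE y z hy h.2.1 h.2.2) hd (hs h'))
  exact absurd hva (hnot a hCa)

/-- A set of at least two vertices of a cograph is disconnected in the graph or in its
complement. -/
theorem IsCograph.hasCut_or_hasCut_compl {V : Type*} {E : V → V → Prop} (hs : Symmetric E)
    (hE : IsCograph E) (S : Finset V) (hS : S.Nontrivial) :
    HasCut E S ∨ HasCut (fun a b => ¬ E a b) S := by
  classical
  induction S using Finset.induction_on with
  | empty => simp at hS
  | insert v T hv ih =>
    by_cases hT : T.Nontrivial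
    · rcases ih hT with h | h
      · exact h.insert hs hE hv
      · have := h.insert (fun a b hab hba => hab (hs hba)) (hE.compl hs) hv
        simpa only [not_not, or_comm] using this
    · obtain ⟨u, hu, huv⟩ := hS.exists_ne v
      have huT : u ∈ T := (Finset.mem_insert.1 hu).resolve_left huv
      have hTu : ∀ x ∈ T, x = u := fun x hx => by
        by_contra hne
        exact hT ⟨x, hx, u, huT, hne⟩
      have hpart : ∀ b ∈ Insert.insert v T, b ≠ v → b = u := fun b hb hbv =>
        hTu b ((Finset.mem_insert.1 hb).resolve_left hbv)
      by_cases hvu : E v u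
      · refine Or.inr ⟨fun x => x = v, ⟨v, by simp, rfl⟩, ⟨u, hu, huv⟩, ?_⟩
        rintro a - b hb rfl hba
        rw [hpart b hb hba]
        exact not_not.2 hvu
      · refine Or.inl ⟨fun x => x = v, ⟨v, by simp, rfl⟩, ⟨u, hu, huv⟩, ?_⟩
        rintro a - b hb rfl hba
        rwa [hpart b hb hba]

/-- The subgraph induced on the vertices satisfying `p`. -/
def FGraph.induce (G : FGraph) (p : G.V → Prop) : FGraph where
  V := {a // p a}
  finite := by have := G.finite; exact inferInstance
  E a b := G.E a b

theorem FGraph.card_induce_lt (G : FGraph) {p : G.V → Prop} {a : G.V} (ha : ¬ p a) :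
    Nat.card (G.induce p).V < Nat.card G.V :=
  have := G.finite
  Finite.card_subtype_lt ha

theorem InC.of_isCograph (G : FGraph) (hs : Symmetric G.E) (hG : IsCograph G.E) : InC G := by
  classical
  induction hn : Nat.card G.V using Nat.strong_induction_on generalizing G with
  | _ n ih =>
    have := G.finite
    have := Fintype.ofFinite G.V
    rcases isEmpty_or_nonempty G.V with h | ⟨⟨v⟩⟩
    · exact .empty G h
    rcases subsingleton_or_nontrivial G.V with h | h
    · exact .single G ⟨v, trivial, fun _ _ => Subsingleton.elim _ _⟩
    have hind : ∀ (p : G.V → Prop) (a : G.V), ¬ p a → InC (G.induce p) := fun p a ha =>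
      ih _ (hn ▸ G.card_induce_lt ha) (G.induce p) (fun x y hxy => hs hxy)
        (fun w x y z => hG w.1 x.1 y.1 z.1) rfl
    rcases hG.hasCut_or_hasCut_compl hs Finset.univ (by simpa using Finset.univ_nontrivial) with
      ⟨p, ⟨a, -, ha⟩, ⟨b, -, hb⟩, hp⟩ | ⟨p, ⟨a, -, ha⟩, ⟨b, -, hb⟩, hp⟩
    · refine .iso _ G (Equiv.sumCompl p) ?_
        (.discSum _ _ (hind p b hb) (hind (fun x => ¬ p x) a (not_not.2 ha)))
      rintro (⟨x, hx⟩ | ⟨x, hx⟩) (⟨y, hy⟩ | ⟨y, hy⟩)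
      · exact Iff.rfl
      · exact iff_of_false id (hp x (by simp) y (by simp) hx hy)
      · exact iff_of_false id fun h => hp y (by simp) x (by simp) hy hx (hs h)
      · exact Iff.rfl
    · refine .iso _ G (Equiv.sumCompl p) ?_
        (.connSum _ _ (hind p b hb) (hind (fun x => ¬ p x) a (not_not.2 ha)))
      rintro (⟨x, hx⟩ | ⟨x, hx⟩) (⟨y, hy⟩ | ⟨y, hy⟩)
      · exact Iff.rfl
      · exact iff_of_true trivial (not_not.1 (hp x (by simp) y (by simp) hx hy))
      · exact iff_of_true trivial (hs (not_not.1 (hp y (by simp) x (by simp) hy hx)))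
      · exact Iff.rfl

theorem InC.symmetric_and_isCograph {G : FGraph} (h : InC G) :
    Symmetric G.E ∧ IsCograph G.E := by
  induction h with
  | empty G h => exact ⟨fun a => h.elim a, fun a => h.elim a⟩
  | single G h =>
    have heq : ∀ a b : G.V, a = b := fun a b => h.unique trivial trivial
    refine ⟨fun a b hab => heq a b ▸ heq a b ▸ hab, fun w x y z hwx _ _ => Or.inl ?_⟩
    rwa [heq y w, heq w x] at *
  | iso G H e he _ ih =>
    have he' : ∀ a b : H.V, H.E a b ↔ G.E (e.symm a) (e.symm b) := fun a b => by simp [he]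
    refine ⟨fun a b hab => (he' _ _).2 (ih.1 ((he' _ _).1 hab)), fun w x y z => ?_⟩
    simp only [he']
    exact ih.2 _ _ _ _
  | connSum G H _ _ ihG ihH =>
    refine ⟨?_, ?_⟩
    · rintro (a | a) (b | b) h
      exacts [ihG.1 h, trivial, trivial, ihH.1 h]
    · rintro (w | w) (x | x) (y | y) (z | z) hwx hyx hyz
      all_goals first
        | exact ihG.2 w x y z hwx hyx hyz
        | exact ihH.2 w x y z hwx hyx hyz
        | exact Or.inl trivial
        | exact Or.inr (Or.inl trivial)
        | exact Or.inr (Or.inr trivial)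
  | discSum G H _ _ ihG ihH =>
    refine ⟨?_, ?_⟩
    · rintro (a | a) (b | b) h
      exacts [ihG.1 h, h.elim, h.elim, ihH.1 h]
    · rintro (w | w) (x | x) (y | y) (z | z) hwx hyx hyz
      all_goals first
        | exact ihG.2 w x y z hwx hyx hyz
        | exact ihH.2 w x y z hwx hyx hyz
        | exact hwx.elim
        | exact hyx.elim
        | exact hyz.elim

/-- A finite graph is a cograph if and only if it belongs to the smallest class of
finite graphs, closed under isomorphism, containing the empty graph and all one-vertex
graphs, and closed under the sums `⊕̄` and `⊕̲`.  In particular every finite cograph is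
generated by singletons under the two sums. -/
theorem isCograph_iff_generated (G : FGraph) (hsymm : Symmetric G.E) :
    IsCograph G.E ↔ InC G := by
  exact ⟨InC.of_isCograph G hsymm, fun h => h.symmetric_and_isCograph.2⟩
end

section
/- For every finite graph, the depth and the co-depth differ by at most 1; that is, co-depth ≤ depth + 1 and depth ≤ co-depth + 1. -/
/-- A *paw of depth `k`* in `(V, E)` is a sequence `x₁, …, x_k` of vertices with
`x₁ ≠ x₂` such that for all `1 ≤ i < j ≤ k`, `(x_i, x_j) ∈ E` iff `j` is even.
(Here `x : Fin k → V` is `0`-indexed, so index `j : Fin k` corresponds to `j + 1`.) -/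
def IsPaw {V : Type*} (E : V → V → Prop) (k : ℕ) (x : Fin k → V) : Prop :=
  (∀ h : 2 ≤ k, x ⟨0, by omega⟩ ≠ x ⟨1, by omega⟩) ∧
    ∀ i j : Fin k, i < j → (E (x i) (x j) ↔ Even ((j : ℕ) + 1))

/-- A *co-paw of depth `k`* in `(V, E)` is a sequence `y₁, …, y_k` of vertices with
`y₁ ≠ y₂` such that for all `i < j`, `(y_i, y_j) ∈ E` iff `j` is odd. -/
def IsCoPaw {V : Type*} (E : V → V → Prop) (k : ℕ) (x : Fin k → V) : Prop :=
  (∀ h : 2 ≤ k, x ⟨0, by omega⟩ ≠ x ⟨1, by omega⟩) ∧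
    ∀ i j : Fin k, i < j → (E (x i) (x j) ↔ Odd ((j : ℕ) + 1))

/-- The *depth* of `(V, E)`: the supremum of the `k` for which there is a paw of
depth `k`. -/
noncomputable def depth {V : Type*} (E : V → V → Prop) : ℕ :=
  sSup {k : ℕ | ∃ x : Fin k → V, IsPaw E k x}

/-- The *co-depth* of `(V, E)`: the supremum of the `k` for which there is a co-paw of
depth `k`. -/
noncomputable def codepth {V : Type*} (E : V → V → Prop) : ℕ :=
  sSup {k : ℕ | ∃ x : Fin k → V, IsCoPaw E k x}

/-- If adjacency of `x i` and `x j`, for `i < j`, depends only on the parity of `j`, and the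
first two terms differ, then `x` is injective. -/
theorem injective_of_alternating {V : Type*} {E : V → V → Prop} (hsymm : Symmetric E)
    {p : ℕ → Prop} (hp : ∀ n, p (n + 1) ↔ ¬ p n) {k : ℕ} {x : Fin k → V}
    (hne : ∀ h : 2 ≤ k, x ⟨0, by omega⟩ ≠ x ⟨1, by omega⟩)
    (hx : ∀ i j : Fin k, i < j → (E (x i) (x j) ↔ p j)) : Function.Injective x := by
  refine Function.Injective.of_lt_imp_ne fun i j hij heq => ?_
  have before : ∀ l : Fin k, l < i → (p i ↔ p j) := fun l hl => by
    rw [← hx l i hl, ← hx l j (hl.trans hij), heq]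
  have between : ∀ l : Fin k, i < l → l < j → (p l ↔ p j) := fun l hil hlj => by
    rw [← hx i l hil, ← hx l j hlj, heq]
    exact ⟨fun h => hsymm h, fun h => hsymm h⟩
  obtain ⟨i, hi⟩ := i
  obtain ⟨j, hj⟩ := j
  simp only [Fin.mk_lt_mk] at hij before between
  obtain rfl | rfl | h : j = i + 1 ∨ j = i + 2 ∨ i + 3 ≤ j := by omega
  · rcases Nat.eq_zero_or_pos i with rfl | hpos
    · exact hne (by omega) heq
    · have h₀ := before ⟨0, by omega⟩ hpos
      have h₁ := hp i
      tauto
  · have h₀ := between ⟨i + 1, by omega⟩ (by simp) (by simp)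
    have h₁ := hp (i + 1)
    simp only at h₀
    tauto
  · have h₀ := between ⟨i + 1, by omega⟩ (by simp) (by simp; omega)
    have h₁ := between ⟨i + 2, by omega⟩ (by simp) (by simp; omega)
    have h₂ := hp (i + 1)
    simp only at h₀ h₁
    tauto

theorem IsPaw.injective {V : Type*} {E : V → V → Prop} (hsymm : Symmetric E) {k : ℕ}
    {x : Fin k → V} (hx : IsPaw E k x) : Function.Injective x :=
  injective_of_alternating (p := fun n => Even (n + 1)) hsymm (fun _ => Nat.even_add_one)
    hx.1 hx.2

theorem IsCoPaw.injective {V : Type*} {E : V → V → Prop} (hsymm : Symmetric E) {k : ℕ}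
    {x : Fin k → V} (hx : IsCoPaw E k x) : Function.Injective x :=
  injective_of_alternating (p := fun n => Odd (n + 1)) hsymm (fun _ => Nat.odd_add_one)
    hx.1 hx.2

/-- Dropping the first vertex of a paw leaves a co-paw. -/
theorem IsPaw.tail {V : Type*} {E : V → V → Prop} (hsymm : Symmetric E) {k : ℕ}
    {x : Fin (k + 1) → V} (hx : IsPaw E (k + 1) x) : IsCoPaw E k (Fin.tail x) := by
  refine ⟨fun h heq => ?_, fun i j hij => ?_⟩
  · simpa using hx.injective hsymm heq
  · refine (hx.2 i.succ j.succ (Fin.succ_lt_succ_iff.2 hij)).trans ?_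
    rw [Fin.val_succ, Nat.even_add_one, Nat.not_even_iff_odd]

/-- Dropping the first vertex of a co-paw leaves a paw. -/
theorem IsCoPaw.tail {V : Type*} {E : V → V → Prop} (hsymm : Symmetric E) {k : ℕ}
    {x : Fin (k + 1) → V} (hx : IsCoPaw E (k + 1) x) : IsPaw E k (Fin.tail x) := by
  refine ⟨fun h heq => ?_, fun i j hij => ?_⟩
  · simpa using hx.injective hsymm heq
  · refine (hx.2 i.succ j.succ (Fin.succ_lt_succ_iff.2 hij)).trans ?_
    rw [Fin.val_succ, Nat.odd_add_one, Nat.not_odd_iff_even]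

theorem bddAbove_isPaw {V : Type*} [Fintype V] {E : V → V → Prop} (hsymm : Symmetric E) :
    BddAbove {k : ℕ | ∃ x : Fin k → V, IsPaw E k x} :=
  ⟨Fintype.card V, fun _ ⟨_, hx⟩ => by
    simpa using Fintype.card_le_of_injective _ (hx.injective hsymm)⟩

theorem bddAbove_isCoPaw {V : Type*} [Fintype V] {E : V → V → Prop} (hsymm : Symmetric E) :
    BddAbove {k : ℕ | ∃ x : Fin k → V, IsCoPaw E k x} :=
  ⟨Fintype.card V, fun _ ⟨_, hx⟩ => by
    simpa using Fintype.card_le_of_injective _ (hx.injective hsymm)⟩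

/-- For every finite graph, the depth and the co-depth differ by at most `1`. -/
theorem codepth_depth_diff_le_one {V : Type*} [Fintype V]
    (E : V → V → Prop) (hsymm : Symmetric E) :
    codepth E ≤ depth E + 1 ∧ depth E ≤ codepth E + 1 := by
  constructor
  · refine csSup_le' ?_
    rintro (_ | k) ⟨x, hx⟩
    · exact Nat.zero_le _
    · exact Nat.succ_le_succ (le_csSup (bddAbove_isPaw hsymm) ⟨_, hx.tail hsymm⟩)
  · refine csSup_le' ?_
    rintro (_ | k) ⟨x, hx⟩
    · exact Nat.zero_le _
    · exact Nat.succ_le_succ (le_csSup (bddAbove_isCoPaw hsymm) ⟨_, hx.tail hsymm⟩)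
end
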